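/- Existence, uniqueness and smoothness of the branch of Langmuir poles (Lemma 2.5, first part): There exist ν₀ > 0, ε ∈ (0, ω_p), and a function p : {k ∈ ℝ³ : |k| < ν₀} → ℂ of class C^∞ such that p(0) = i·ω_p, |p(k) − i·ω_p| < ε for all |k| < ν₀, 𝓛(p(k), |k|) = 1 for all k with 0 < |k| < ν₀, and moreover for every k with 0 < |k| < ν₀, p(k) is the unique z ∈ ℂ with |z − i·ω_p| < ε and 𝓛(z, |k|) = 1. -/

import Mathlib

open MeasureTheory Complex

/-- The Fourier transform of the Maxwellian along a fixed direction:
`F(s) = n₀ · exp(−β s²/2)`. -/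
noncomputable def Fmax (n₀ β : ℝ) (s : ℝ) : ℝ := n₀ * Real.exp (-β * s ^ 2 / 2)

/-- The plasma dispersion function
`𝓛(z,κ) = −(w₀/κ²) ∫₀^∞ s F(s) exp(−(z/κ) s) ds` with `w₀ = ωp²/n₀`. -/
noncomputable def disp (n₀ β ωp : ℝ) (z : ℂ) (κ : ℝ) : ℂ :=
  -(((ωp ^ 2 / n₀ : ℝ) : ℂ) / (κ : ℂ) ^ 2) *
    ∫ s in Set.Ioi (0 : ℝ),
      ((s : ℝ) : ℂ) * ((Fmax n₀ β s : ℝ) : ℂ) * Complex.exp (-(z / (κ : ℂ)) * ((s : ℝ) : ℂ))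

open Filter Topology

/-- Integrability of the elementary majorants. -/
theorem lang_int (n : ℕ) {δ : ℝ} (hδ : 0 < δ) :
    Integrable (fun r : ℝ => r ^ n * Real.exp (-δ * r)) (volume.restrict (Set.Ioi 0)) := by
  have h := integrableOn_rpow_mul_exp_neg_mul_rpow (p := 1) (s := n) (b := δ)
    (by have : (0:ℝ) ≤ n := Nat.cast_nonneg n
        linarith) one_pos hδ
  simpa [IntegrableOn] using h

/-- The integrand of the rotated moment integrals. -/
noncomputable def lang_e (β : ℝ) (n : ℕ) (x : ℂ × ℝ) (r : ℝ) : ℂ :=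
  (r : ℂ) ^ n * cexp (I * β * x.2 * (r : ℂ) ^ 2 - x.1 * (1 - I) * r)

/-- The rotated moment integrals. -/
noncomputable def lang_M (β : ℝ) (n : ℕ) (x : ℂ × ℝ) : ℂ :=
  ∫ r in Set.Ioi (0 : ℝ), lang_e β n x r

/-- The projections as real linear maps with complex values. -/
noncomputable def lang_fst : ℂ × ℝ →L[ℝ] ℂ := ContinuousLinearMap.fst ℝ ℂ ℝ
noncomputable def lang_snd : ℂ × ℝ →L[ℝ] ℂ := ofRealCLM.comp (ContinuousLinearMap.snd ℝ ℂ ℝ)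

theorem lang_e_cont (β : ℝ) (n : ℕ) (x : ℂ × ℝ) : Continuous (lang_e β n x) := by
  unfold lang_e; fun_prop

theorem lang_e_norm (β : ℝ) (n : ℕ) (x : ℂ × ℝ) {r : ℝ} (hr : 0 < r) :
    ‖lang_e β n x r‖ = r ^ n * Real.exp (-(x.1.re + x.1.im) * r) := by
  unfold lang_e
  rw [norm_mul, norm_pow, Complex.norm_real, Real.norm_of_nonneg hr.le, Complex.norm_exp]
  congr 2
  simp [pow_two]
  ring

theorem lang_e_le (β : ℝ) (n : ℕ) (x : ℂ × ℝ) {r δ : ℝ} (hr : 0 < r)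
    (hδ : δ ≤ x.1.re + x.1.im) :
    ‖lang_e β n x r‖ ≤ r ^ n * Real.exp (-δ * r) := by
  rw [lang_e_norm β n x hr]
  gcongr

theorem lang_e_int (β : ℝ) (n : ℕ) (x : ℂ × ℝ) (hx : 0 < x.1.re + x.1.im) :
    Integrable (lang_e β n x) (volume.restrict (Set.Ioi 0)) := by
  refine (lang_int n hx).mono' (lang_e_cont β n x).aestronglyMeasurable ?_
  filter_upwards [ae_restrict_mem measurableSet_Ioi] with r hr
  exact lang_e_le β n x hr le_rfl

/-- The derivative of the integrand. -/
noncomputable def lang_e' (β : ℝ) (n : ℕ) (x : ℂ × ℝ) (r : ℝ) : ℂ × ℝ →L[ℝ] ℂ :=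
  (-(1 - I) * lang_e β (n + 1) x r) • lang_fst + (I * β * lang_e β (n + 2) x r) • lang_snd

theorem lang_e_deriv (β : ℝ) (n : ℕ) (x : ℂ × ℝ) (r : ℝ) :
    HasFDerivAt (fun x => lang_e β n x r) (lang_e' β n x r) x := by
  have h1 : HasFDerivAt (fun x : ℂ × ℝ => x.1) lang_fst x := lang_fst.hasFDerivAt
  have h2 : HasFDerivAt (fun x : ℂ × ℝ => (x.2 : ℂ)) lang_snd x := lang_snd.hasFDerivAt
  have h3 := (((h2.const_mul (I * β)).mul_const ((r : ℂ) ^ 2)).sub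
    ((h1.mul_const (1 - I)).mul_const (r : ℂ))).cexp.const_mul ((r : ℂ) ^ n)
  refine h3.congr_fderiv ?_
  ext v <;> simp [lang_e', lang_e] <;> ring

theorem lang_M_deriv (β : ℝ) (n : ℕ) (x : ℂ × ℝ) (hx : 0 < x.1.re + x.1.im) :
    HasFDerivAt (lang_M β n)
      ((-(1 - I) * lang_M β (n + 1) x) • lang_fst + (I * β * lang_M β (n + 2) x) • lang_snd) x := by
  set δ := (x.1.re + x.1.im) / 2 with hδ
  have hδ0 : 0 < δ := by positivity
  have hs : {y : ℂ × ℝ | δ < y.1.re + y.1.im} ∈ 𝓝 x := by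
    refine IsOpen.mem_nhds ?_ ?_
    · exact isOpen_lt (by fun_prop) (by fun_prop)
    · show δ < x.1.re + x.1.im; linarith
  have key := hasFDerivAt_integral_of_dominated_of_fderiv_le (𝕜 := ℝ)
    (μ := volume.restrict (Set.Ioi (0:ℝ))) (F := lang_e β n) (F' := lang_e' β n) (x₀ := x)
    (bound := fun r => ‖-(1 - I)‖ * ‖lang_fst‖ * (r ^ (n + 1) * Real.exp (-δ * r)) +
      ‖I * β‖ * ‖lang_snd‖ * (r ^ (n + 2) * Real.exp (-δ * r))) hs
    (Eventually.of_forall fun y => (lang_e_cont β n y).aestronglyMeasurable)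
    (lang_e_int β n x hx)
    (by
      refine Continuous.aestronglyMeasurable ?_
      have h1 := lang_e_cont β (n + 1) x
      have h2 := lang_e_cont β (n + 2) x
      unfold lang_e'
      fun_prop)
    (by
      filter_upwards [ae_restrict_mem measurableSet_Ioi] with r hr y hy
      have h1 := lang_e_le β (n + 1) y hr (le_of_lt hy)
      have h2 := lang_e_le β (n + 2) y hr (le_of_lt hy)
      refine (norm_add_le _ _).trans ?_
      rw [norm_smul, norm_smul, norm_mul, norm_mul (I * (β : ℂ))]
      refine add_le_add ?_ ?_
      · calc _ = ‖-(1 - I)‖ * ‖lang_fst‖ * ‖lang_e β (n + 1) y r‖ := by ring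
          _ ≤ _ := by gcongr
      · calc _ = ‖I * β‖ * ‖lang_snd‖ * ‖lang_e β (n + 2) y r‖ := by ring
          _ ≤ _ := by gcongr)
    (((lang_int (n + 1) hδ0).const_mul _).add ((lang_int (n + 2) hδ0).const_mul _))
    (Eventually.of_forall fun r y _ => lang_e_deriv β n y r)
  refine key.congr_fderiv ?_
  unfold lang_e'
  rw [integral_add, integral_smul_const, integral_smul_const, integral_const_mul,
    integral_const_mul]
  · rfl
  · exact ((lang_e_int β (n + 1) x hx).const_mul _).smul_const _
  · exact ((lang_e_int β (n + 2) x hx).const_mul _).smul_const _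

theorem lang_open : IsOpen {y : ℂ × ℝ | 0 < y.1.re + y.1.im} :=
  isOpen_lt (by fun_prop) (by fun_prop)

theorem lang_M_contDiff_nat (β : ℝ) (m : ℕ) : ∀ n : ℕ,
    ContDiffOn ℝ m (lang_M β n) {y : ℂ × ℝ | 0 < y.1.re + y.1.im} := by
  induction m with
  | zero =>
    intro n
    rw [Nat.cast_zero, contDiffOn_zero]
    exact fun x hx => (lang_M_deriv β n x hx).continuousAt.continuousWithinAt
  | succ m ih =>
    intro n
    rw [Nat.cast_succ, contDiffOn_succ_iff_hasFDerivWithinAt_of_uniqueDiffOn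
      lang_open.uniqueDiffOn]
    refine ⟨fun h => absurd h (by simp), _, ?_,
      fun x hx => (lang_M_deriv β n x hx).hasFDerivWithinAt⟩
    have h1 := ih (n + 1)
    have h2 := ih (n + 2)
    exact ((contDiffOn_const.mul h1).smul contDiffOn_const).add
      ((contDiffOn_const.mul h2).smul contDiffOn_const)

theorem lang_M_contDiff (β : ℝ) (n : ℕ) :
    ContDiffOn ℝ (⊤ : ℕ∞) (lang_M β n) {y : ℂ × ℝ | 0 < y.1.re + y.1.im} :=
  contDiffOn_infty.2 fun m => lang_M_contDiff_nat β m n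

theorem lang_tend (n : ℕ) {δ : ℝ} (hδ : 0 < δ) :
    Tendsto (fun r : ℝ => r ^ n * Real.exp (-δ * r)) atTop (𝓝 0) := by
  have h := tendsto_rpow_mul_exp_neg_mul_atTop_nhds_zero n δ hδ
  simpa using h

theorem lang_e_tend (β : ℝ) (n : ℕ) (x : ℂ × ℝ) (hx : 0 < x.1.re + x.1.im) :
    Tendsto (lang_e β n x) atTop (𝓝 0) := by
  refine squeeze_zero_norm' ?_ (lang_tend n hx)
  filter_upwards [eventually_gt_atTop 0] with r hr
  exact lang_e_le β n x hr le_rfl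

theorem lang_M_zero (β : ℝ) (z : ℂ) (hz : 0 < z.re + z.im) :
    z * (1 - I) * lang_M β 0 (z, 0) = 1 := by
  have h := integral_Ioi_of_hasDerivAt_of_tendsto' (a := 0) (m := 0)
    (f := lang_e β 0 (z, 0)) (f' := fun r => -(z * (1 - I)) * lang_e β 0 (z, 0) r)
    (fun r _ => by
      have h1 : HasDerivAt (fun r : ℝ => (r : ℂ)) 1 r := ofRealCLM.hasDerivAt
      have h2 := (h1.const_mul (-(z * (1 - I)))).cexp
      refine (h2.congr_deriv ?_).congr_of_eventuallyEq (Eventually.of_forall fun s => ?_)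
      · simp [lang_e]; ring
      · simp [lang_e])
    ((lang_e_int β 0 (z, 0) hz).const_mul _) (lang_e_tend β 0 (z, 0) hz)
  rw [integral_const_mul] at h
  have h0 : lang_e β 0 (z, 0) 0 = 1 := by simp [lang_e]
  rw [h0] at h
  unfold lang_M
  linear_combination -h

theorem lang_M_succ (β : ℝ) (n : ℕ) (z : ℂ) (hz : 0 < z.re + z.im) :
    z * (1 - I) * lang_M β (n + 1) (z, 0) = (n + 1) * lang_M β n (z, 0) := by
  have h := integral_Ioi_of_hasDerivAt_of_tendsto' (a := 0) (m := 0)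
    (f := lang_e β (n + 1) (z, 0)) (f' := fun r => (n + 1) * lang_e β n (z, 0) r -
      (z * (1 - I)) * lang_e β (n + 1) (z, 0) r)
    (fun r _ => by
      have h1 : HasDerivAt (fun r : ℝ => (r : ℂ)) 1 r := ofRealCLM.hasDerivAt
      have h2 := (h1.pow (n + 1)).mul (h1.const_mul (-(z * (1 - I)))).cexp
      refine (h2.congr_deriv ?_).congr_of_eventuallyEq (Eventually.of_forall fun s => ?_)
      · simp [lang_e]; ring
      · simp [lang_e])
    (((lang_e_int β n (z, 0) hz).const_mul _).sub ((lang_e_int β (n + 1) (z, 0) hz).const_mul _))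
    (lang_e_tend β (n + 1) (z, 0) hz)
  rw [integral_sub ((lang_e_int β n (z, 0) hz).const_mul _)
    ((lang_e_int β (n + 1) (z, 0) hz).const_mul _), integral_const_mul, integral_const_mul] at h
  have h0 : lang_e β (n + 1) (z, 0) 0 = 0 := by simp [lang_e]
  rw [h0] at h
  unfold lang_M
  linear_combination -h

/-- The contour-rotated integrand. -/
noncomputable def lang_φ (β : ℝ) (A c : ℂ) (r : ℝ) : ℂ :=
  c ^ 2 * r * cexp (-(β / 2) * c ^ 2 * (r : ℂ) ^ 2 - A * c * r)

theorem lang_exp_le {η M r : ℝ} (hη : 0 < η) :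
    Real.exp (-η * r ^ 2 + M * r) ≤ Real.exp ((M + 1) ^ 2 / (4 * η)) * Real.exp (-1 * r) := by
  rw [← Real.exp_add]
  apply Real.exp_le_exp.2
  have : (M + 1) * r - η * r ^ 2 ≤ (M + 1) ^ 2 / (4 * η) := by
    rw [le_div_iff₀ (by positivity)]
    nlinarith [sq_nonneg (M + 1 - 2 * η * r)]
  linarith

theorem lang_rot_bound {β : ℝ} (hβ : 0 < β) (A c : ℂ) {m R r : ℝ}
    (hc : m ≤ (c ^ 2).re) (hR : ‖c‖ ≤ R) (hr : 0 < r) :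
    ‖cexp (-(β / 2) * c ^ 2 * (r : ℂ) ^ 2 - A * c * r)‖ ≤
      Real.exp (-(β / 2 * m) * r ^ 2 + (‖A‖ * R) * r) := by
  rw [Complex.norm_exp]
  apply Real.exp_le_exp.2
  have e : (-(β / 2) * c ^ 2 * (r : ℂ) ^ 2 - A * c * r).re =
      -(β / 2 * (c ^ 2).re) * r ^ 2 + (-(A * c).re) * r := by
    have : (-(β / 2) * c ^ 2 * (r : ℂ) ^ 2 - A * c * r) =
      ((-(β / 2) * r ^ 2 : ℝ) : ℂ) * c ^ 2 - ((r : ℝ) : ℂ) * (A * c) := by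
      push_cast; ring
    rw [this, sub_re, re_ofReal_mul, re_ofReal_mul]; ring
  rw [e]
  have h1 : -(A * c).re ≤ ‖A‖ * R := by
    calc -(A * c).re ≤ |(A * c).re| := neg_le_abs _
      _ ≤ ‖A * c‖ := abs_re_le_norm _
      _ = ‖A‖ * ‖c‖ := norm_mul _ _
      _ ≤ _ := by gcongr
  gcongr

theorem lang_rot_deriv {β : ℝ} (hβ : 0 < β) (A c₀ : ℂ) (hc : 0 < (c₀ ^ 2).re) :
    HasDerivAt (fun c => ∫ r in Set.Ioi (0:ℝ), lang_φ β A c r) 0 c₀ := by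
  set m := (c₀ ^ 2).re / 2 with hm
  have hm0 : 0 < m := by positivity
  set R := ‖c₀‖ + 1 with hR
  have hR0 : 0 ≤ R := by positivity
  set η := β / 2 * m with hη
  have hη0 : 0 < η := by positivity
  set C := Real.exp ((‖A‖ * R + 1) ^ 2 / (4 * η)) with hC
  have hs : {c : ℂ | m < (c ^ 2).re ∧ ‖c‖ < R} ∈ 𝓝 c₀ := by
    refine IsOpen.mem_nhds ?_ ?_
    · exact (isOpen_lt (f := fun _ : ℂ => m) (g := fun c : ℂ => (c ^ 2).re) (by fun_prop)
        (by fun_prop)).inter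
        (isOpen_lt (f := fun c : ℂ => ‖c‖) (g := fun _ : ℂ => R) (by fun_prop) (by fun_prop))
    · exact ⟨by linarith, by linarith⟩
  have hb : ∀ c ∈ {c : ℂ | m < (c ^ 2).re ∧ ‖c‖ < R}, ∀ r : ℝ, 0 < r →
      ‖cexp (-(β / 2) * c ^ 2 * (r : ℂ) ^ 2 - A * c * r)‖ ≤ C * Real.exp (-1 * r) := by
    intro c hc r hr
    exact (lang_rot_bound hβ A c hc.1.le hc.2.le hr).trans (lang_exp_le hη0)
  have hc₀ := mem_of_mem_nhds hs
  set F' : ℂ → ℝ → ℂ := fun c r =>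
    (2 * c * r - β * c ^ 3 * (r : ℂ) ^ 3 - A * c ^ 2 * (r : ℂ) ^ 2) *
      cexp (-(β / 2) * c ^ 2 * (r : ℂ) ^ 2 - A * c * r) with hF'
  have key := hasDerivAt_integral_of_dominated_loc_of_deriv_le (𝕜 := ℂ)
    (μ := volume.restrict (Set.Ioi (0:ℝ))) (F := lang_φ β A) (F' := F') (x₀ := c₀)
    (bound := fun r => 2 * R * C * (r ^ 1 * Real.exp (-1 * r)) +
      β * R ^ 3 * C * (r ^ 3 * Real.exp (-1 * r)) +
      ‖A‖ * R ^ 2 * C * (r ^ 2 * Real.exp (-1 * r))) hs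
    (Eventually.of_forall fun c => by
      refine Continuous.aestronglyMeasurable ?_
      unfold lang_φ; fun_prop)
    (by
      refine ((lang_int 1 one_pos).const_mul (R ^ 2 * C)).mono' ?_ ?_
      · refine Continuous.aestronglyMeasurable ?_
        unfold lang_φ; fun_prop
      · filter_upwards [ae_restrict_mem measurableSet_Ioi] with r hr
        have hr' : (0:ℝ) < r := hr
        have := hb c₀ hc₀ r hr
        unfold lang_φ
        rw [norm_mul, norm_mul, norm_pow, Complex.norm_real, Real.norm_of_nonneg hr'.le]
        calc _ ≤ R ^ 2 * r * (C * Real.exp (-1 * r)) := by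
              gcongr
              exact hc₀.2.le
          _ = _ := by ring)
    (by
      refine Continuous.aestronglyMeasurable ?_
      rw [hF']; fun_prop)
    (by
      filter_upwards [ae_restrict_mem measurableSet_Ioi] with r hr c hc
      have hr' : (0:ℝ) < r := hr
      have h1 := hb c hc r hr
      have hcR : ‖c‖ ≤ R := hc.2.le
      have h2 : ‖2 * c * r - β * c ^ 3 * (r : ℂ) ^ 3 - A * c ^ 2 * (r : ℂ) ^ 2‖ ≤
          2 * R * r + β * R ^ 3 * r ^ 3 + ‖A‖ * R ^ 2 * r ^ 2 := by
        refine (norm_sub_le _ _).trans (add_le_add ((norm_sub_le _ _).trans (add_le_add ?_ ?_)) ?_)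
        all_goals
          simp only [norm_mul, norm_pow, Complex.norm_real, Real.norm_of_nonneg hr'.le,
            Real.norm_of_nonneg hβ.le, Complex.norm_ofNat]
          gcongr
      rw [hF']
      rw [norm_mul]
      calc _ ≤ (2 * R * r + β * R ^ 3 * r ^ 3 + ‖A‖ * R ^ 2 * r ^ 2) *
            (C * Real.exp (-1 * r)) := by gcongr
        _ = _ := by ring)
    ((((lang_int 1 one_pos).const_mul _).add ((lang_int 3 one_pos).const_mul _)).add
      ((lang_int 2 one_pos).const_mul _))
    (Eventually.of_forall fun r c _ => by
      have h1 := hasDerivAt_id c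
      have h2 := ((h1.pow 2).mul_const (r : ℂ)).mul
        ((((h1.pow 2).const_mul (-(β / 2 : ℂ))).mul_const ((r : ℂ) ^ 2)).sub
          ((h1.const_mul A).mul_const (r : ℂ))).cexp
      refine h2.congr_deriv ?_
      simp [hF']; ring)
  have h0 : ∫ r in Set.Ioi (0:ℝ), F' c₀ r = 0 := by
    have := integral_Ioi_of_hasDerivAt_of_tendsto' (a := 0) (m := 0)
      (f := fun r : ℝ => c₀ * (r : ℂ) ^ 2 * cexp (-(β / 2) * c₀ ^ 2 * (r : ℂ) ^ 2 - A * c₀ * r))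
      (f' := F' c₀)
      (fun r _ => by
        have h1 : HasDerivAt (fun r : ℝ => (r : ℂ)) 1 r := ofRealCLM.hasDerivAt
        have h2 := ((h1.pow 2).const_mul c₀).mul
          (((h1.pow 2).const_mul (-(β / 2) * c₀ ^ 2)).sub (h1.const_mul (A * c₀))).cexp
        refine h2.congr_deriv ?_
        simp [hF']; ring)
      key.1
      (by
        have ht := (lang_tend 2 one_pos).const_mul (R * C)
        rw [mul_zero] at ht
        refine squeeze_zero_norm' ?_ ht
        filter_upwards [eventually_gt_atTop 0] with r hr
        have h1 := hb c₀ hc₀ r hr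
        have hcR : ‖c₀‖ ≤ R := hc₀.2.le
        rw [norm_mul, norm_mul, norm_pow, Complex.norm_real, Real.norm_of_nonneg hr.le]
        calc _ ≤ R * r ^ 2 * (C * Real.exp (-1 * r)) := by gcongr
          _ = _ := by ring)
    rw [this]; simp
  rw [h0] at key
  exact key.2

theorem lang_rot_const {β : ℝ} (hβ : 0 < β) (A : ℂ) {c : ℂ} (h1 : 0 < c.re + c.im)
    (h2 : 0 < c.re - c.im) :
    ∫ r in Set.Ioi (0:ℝ), lang_φ β A c r = ∫ r in Set.Ioi (0:ℝ), lang_φ β A 1 r := by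
  set S : Set ℂ := {c : ℂ | 0 < c.re + c.im} ∩ {c : ℂ | 0 < c.re - c.im} with hS
  have ho : IsOpen S :=
    (isOpen_lt (by fun_prop) (by fun_prop)).inter (isOpen_lt (by fun_prop) (by fun_prop))
  have hconv : Convex ℝ S := by
    refine (convex_halfSpace_gt (f := fun c : ℂ => c.re + c.im) ?_ 0).inter
      (convex_halfSpace_gt (f := fun c : ℂ => c.re - c.im) ?_ 0)
    · exact (reCLM + imCLM).toLinearMap.isLinear
    · exact (reCLM - imCLM).toLinearMap.isLinear
  have hd : ∀ c ∈ S, HasDerivAt (fun c => ∫ r in Set.Ioi (0:ℝ), lang_φ β A c r) 0 c := by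
    intro c hc
    refine lang_rot_deriv hβ A c ?_
    have h3 : 0 < c.re + c.im := hc.1
    have h4 : 0 < c.re - c.im := hc.2
    have := mul_pos h3 h4
    simp only [pow_two, mul_re]
    nlinarith
  refine ho.is_const_of_deriv_eq_zero hconv.isPreconnected
    (fun c hc => (hd c hc).differentiableAt.differentiableWithinAt)
    (fun c hc => (hd c hc).deriv) ⟨h1, h2⟩ ?_
  simp [hS]

theorem lang_rot {β ωp κ : ℝ} (hβ : 0 < β) (hω : 0 < ωp) (hκ : 0 < κ) {z : ℂ}
    (hz : ‖z - I * ωp‖ < ωp / 4) :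
    ∫ r in Set.Ioi (0:ℝ), lang_φ β (z / κ) 1 r = -2 * I * κ ^ 2 * lang_M β 1 (z, κ ^ 2) := by
  have hre : -(ωp / 4) < z.re := by
    have := (abs_re_le_norm (z - I * ωp)).trans_lt hz
    simp at this
    linarith [(abs_lt.1 this).1]
  have him : 3 * ωp / 4 < z.im := by
    have := (abs_im_le_norm (z - I * ωp)).trans_lt hz
    simp at this
    linarith [(abs_lt.1 this).1]
  have hκ' : (κ : ℂ) ≠ 0 := ofReal_ne_zero.2 hκ.ne'
  set c : ℝ → ℂ := fun x => κ * (1 - x * I) with hcdef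
  have hmem : ∀ᶠ x in 𝓝[<] (1:ℝ), x ∈ Set.Ioo (1/2 : ℝ) 1 :=
    Ioo_mem_nhdsLT (by norm_num)
  have hT : Tendsto (fun x => ∫ r in Set.Ioi (0:ℝ), lang_φ β (z / κ) (c x) r) (𝓝[<] 1)
      (𝓝 (∫ r in Set.Ioi (0:ℝ), lang_φ β (z / κ) (c 1) r)) := by
    refine tendsto_integral_filter_of_dominated_convergence
      (fun r => (2 * κ) ^ 2 * (r ^ 1 * Real.exp (-(ωp / 8) * r))) ?_ ?_
      ((lang_int 1 (by positivity)).const_mul _) ?_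
    · refine Eventually.of_forall fun x => Continuous.aestronglyMeasurable ?_
      unfold lang_φ; fun_prop
    · filter_upwards [hmem] with x hx
      filter_upwards [ae_restrict_mem measurableSet_Ioi] with r hr
      have hr' : (0:ℝ) < r := hr
      have hx0 : 1 / 2 < x := hx.1
      have hx1 : x < 1 := hx.2
      have hcn : ‖c x‖ ≤ 2 * κ := by
        rw [hcdef]
        simp only [norm_mul, Complex.norm_real, Real.norm_of_nonneg hκ.le]
        have : ‖1 - (x : ℂ) * I‖ ≤ 2 := by
          refine (norm_sub_le _ _).trans ?_
          simp only [norm_one, norm_mul, Complex.norm_real, norm_I, mul_one,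
            Real.norm_of_nonneg (by linarith : 0 ≤ x)]
          linarith
        nlinarith
      unfold lang_φ
      rw [norm_mul, norm_mul, norm_pow, Complex.norm_real, Real.norm_of_nonneg hr'.le,
        Complex.norm_exp, pow_one]
      have e1 : -(β / 2 : ℂ) * c x ^ 2 * (r : ℂ) ^ 2 - z / κ * c x * r =
          ((-(β / 2) * r ^ 2 * κ ^ 2 : ℝ) : ℂ) * (1 - x * I) ^ 2 - ((r : ℝ) : ℂ) * (z * (1 - x * I)) := by
        rw [hcdef]; push_cast; field_simp
      have e2 : (-(β / 2 : ℂ) * c x ^ 2 * (r : ℂ) ^ 2 - z / κ * c x * r).re ≤ -(ωp / 8) * r := by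
        rw [e1, sub_re, re_ofReal_mul, re_ofReal_mul]
        have e3 : ((1 - (x : ℂ) * I) ^ 2).re = 1 - x ^ 2 := by simp [pow_two]
        have e4 : (z * (1 - (x : ℂ) * I)).re = z.re + x * z.im := by simp; ring
        rw [e3, e4]
        have h1 : 0 ≤ (β / 2) * r ^ 2 * κ ^ 2 * (1 - x ^ 2) := by
          have : 0 ≤ 1 - x ^ 2 := by nlinarith
          positivity
        have h2 : ωp / 8 ≤ z.re + x * z.im := by nlinarith
        nlinarith
      calc _ ≤ (2 * κ) ^ 2 * r * Real.exp (-(ωp / 8) * r) := by gcongr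
        _ = _ := by ring
    · refine Eventually.of_forall fun r => ?_
      have : Continuous (fun x => lang_φ β (z / κ) (c x) r) := by
        unfold lang_φ; rw [hcdef]; fun_prop
      exact (this.tendsto 1).mono_left nhdsWithin_le_nhds
  have hE : ∀ᶠ x in 𝓝[<] (1:ℝ), ∫ r in Set.Ioi (0:ℝ), lang_φ β (z / κ) (c x) r =
      ∫ r in Set.Ioi (0:ℝ), lang_φ β (z / κ) 1 r := by
    filter_upwards [hmem] with x hx
    have hx0 : 1 / 2 < x := hx.1
    have hx1 : x < 1 := hx.2
    apply lang_rot_const hβ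
    · simp [hcdef]; nlinarith
    · simp [hcdef]; nlinarith
  have hU := tendsto_nhds_unique (tendsto_const_nhds.congr' (hE.mono fun x hx => hx.symm)) hT
  rw [hU]
  unfold lang_M
  rw [← integral_const_mul]
  congr 1
  funext r
  have hI : (1 - I) ^ 2 = -2 * I := by
    linear_combination I_sq
  have hc2 : c 1 ^ 2 = -2 * I * κ ^ 2 := by
    simp only [hcdef, ofReal_one, one_mul, mul_pow, hI]; ring
  simp only [lang_φ, lang_e, hc2, pow_one]
  rw [mul_assoc]
  congr 2
  congr 1
  simp only [hcdef]
  push_cast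
  field_simp

theorem lang_disp {n₀ β ωp κ : ℝ} (hn : 0 < n₀) (hβ : 0 < β) (hω : 0 < ωp) (hκ : 0 < κ) {z : ℂ}
    (hz : ‖z - I * ωp‖ < ωp / 4) :
    disp n₀ β ωp z κ = 2 * I * ωp ^ 2 * lang_M β 1 (z, κ ^ 2) := by
  have hκ' : (κ : ℂ) ≠ 0 := ofReal_ne_zero.2 hκ.ne'
  have hn' : (n₀ : ℂ) ≠ 0 := ofReal_ne_zero.2 hn.ne'
  have h : ∫ s in Set.Ioi (0 : ℝ),
      ((s : ℝ) : ℂ) * ((Fmax n₀ β s : ℝ) : ℂ) * Complex.exp (-(z / (κ : ℂ)) * ((s : ℝ) : ℂ)) =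
      n₀ * ∫ r in Set.Ioi (0:ℝ), lang_φ β (z / κ) 1 r := by
    rw [← integral_const_mul]
    congr 1
    funext r
    have : (-(β / 2 : ℂ) * 1 ^ 2 * (r : ℂ) ^ 2 - z / κ * 1 * r) =
        (-β * r ^ 2 / 2) + (-(z / κ) * r) := by ring
    simp only [lang_φ, Fmax, this, Complex.exp_add]
    push_cast
    ring
  unfold disp
  rw [h, lang_rot hβ hω hκ hz]
  push_cast
  field_simp

/-- A shear map with nonzero scaling is a real linear equivalence. -/
noncomputable def lang_equiv (A B : ℂ) (hA : A ≠ 0) : (ℂ × ℝ) ≃L[ℝ] (ℂ × ℝ) :=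
  ContinuousLinearEquiv.equivOfInverse
    ((A • lang_fst + B • lang_snd).prod (ContinuousLinearMap.snd ℝ ℂ ℝ))
    ((A⁻¹ • (lang_fst - B • lang_snd)).prod (ContinuousLinearMap.snd ℝ ℂ ℝ))
    (by
      rintro ⟨w, τ⟩
      simp [lang_fst, lang_snd, hA])
    (by
      rintro ⟨w, τ⟩
      simp [lang_fst, lang_snd, hA])

/-- The straightened dispersion map. -/
noncomputable def lang_g (β ωp : ℝ) (x : ℂ × ℝ) : ℂ × ℝ :=
  (2 * I * ωp ^ 2 * lang_M β 1 x, x.2)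

theorem lang_g_deriv {β ωp : ℝ} (hω : 0 < ωp) (x : ℂ × ℝ) (hx : 0 < x.1.re + x.1.im)
    (h2 : lang_M β 2 x ≠ 0) :
    ∃ L : (ℂ × ℝ) ≃L[ℝ] (ℂ × ℝ),
      HasFDerivAt (lang_g β ωp) (L : (ℂ × ℝ) →L[ℝ] (ℂ × ℝ)) x := by
  have hω' : (ωp : ℂ) ≠ 0 := ofReal_ne_zero.2 hω.ne'
  have hI : (1 - I : ℂ) ≠ 0 := by
    intro h
    have := congrArg Complex.re h
    simp at this
  have hA : 2 * I * ωp ^ 2 * (-(1 - I) * lang_M β 2 x) ≠ 0 :=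
    mul_ne_zero (mul_ne_zero (mul_ne_zero two_ne_zero I_ne_zero) (pow_ne_zero _ hω'))
      (mul_ne_zero (neg_ne_zero.2 hI) h2)
  refine ⟨lang_equiv _ (2 * I * ωp ^ 2 * (I * β * lang_M β 3 x)) hA, ?_⟩
  have h := ((lang_M_deriv β 1 x hx).const_mul (2 * I * ωp ^ 2)).prodMk
    (ContinuousLinearMap.snd ℝ ℂ ℝ).hasFDerivAt
  refine h.congr_fderiv ?_
  ext v <;> simp [lang_equiv, ContinuousLinearEquiv.equivOfInverse] <;> ring

theorem lang_g_contDiff (β ωp : ℝ) (x : ℂ × ℝ) (hx : 0 < x.1.re + x.1.im) :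
    ContDiffAt ℝ (⊤ : ℕ∞) (lang_g β ωp) x :=
  (contDiffAt_const.mul ((lang_M_contDiff β 1).contDiffAt (lang_open.mem_nhds hx))).prodMk
    contDiffAt_snd

/-- **Existence, uniqueness and smoothness of the branch of Langmuir poles**
(Lemma 2.5, first part). -/
theorem langmuir_pole_branch_exists_unique_smooth
    (n₀ β ωp : ℝ) (hn : 0 < n₀) (hβ : 0 < β) (hω : 0 < ωp) :
    ∃ ν₀ > (0:ℝ), ∃ ε ∈ Set.Ioo (0:ℝ) ωp, ∃ p : EuclideanSpace ℝ (Fin 3) → ℂ,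
      ContDiffOn ℝ (⊤ : ℕ∞) p (Metric.ball 0 ν₀) ∧
      p 0 = Complex.I * (ωp : ℂ) ∧
      (∀ k : EuclideanSpace ℝ (Fin 3), ‖k‖ < ν₀ → ‖p k - Complex.I * (ωp : ℂ)‖ < ε) ∧
      (∀ k : EuclideanSpace ℝ (Fin 3), 0 < ‖k‖ → ‖k‖ < ν₀ →
        disp n₀ β ωp (p k) ‖k‖ = 1) ∧
      (∀ k : EuclideanSpace ℝ (Fin 3), 0 < ‖k‖ → ‖k‖ < ν₀ →
        ∀ z : ℂ, ‖z - Complex.I * (ωp : ℂ)‖ < ε → disp n₀ β ωp z ‖k‖ = 1 → z = p k) := by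
  have hω' : (ωp : ℂ) ≠ 0 := ofReal_ne_zero.2 hω.ne'
  set x₀ : ℂ × ℝ := (I * ωp, 0) with hx₀
  have hx : 0 < x₀.1.re + x₀.1.im := by simpa [hx₀] using hω
  have hM0 := lang_M_zero β (I * ωp) hx
  have hM1 := lang_M_succ β 0 (I * ωp) hx
  have hM2 := lang_M_succ β 1 (I * ωp) hx
  have hM0' : lang_M β 0 x₀ ≠ 0 := fun h => by rw [← hx₀, h] at hM0; simp at hM0
  have hM1' : lang_M β 1 x₀ ≠ 0 := fun h => by
    rw [← hx₀, h] at hM1; simp at hM1; exact hM0' hM1.symm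
  have hM2' : lang_M β 2 x₀ ≠ 0 := fun h => by
    rw [← hx₀, show 1 + 1 = 2 from rfl, h] at hM2; norm_num at hM2; exact hM1' hM2
  have hg0 : lang_g β ωp x₀ = (1, 0) := by
    have : 2 * I * ωp ^ 2 * lang_M β 1 x₀ = 1 := by
      rw [← hx₀] at hM0 hM1
      norm_num at hM1
      linear_combination hM0 + (I * ωp * (1 - I)) * hM1 +
        ωp ^ 2 * (2 * I - I ^ 2) * lang_M β 1 x₀ * I_sq
    rw [lang_g, this]
  obtain ⟨L, hL⟩ := lang_g_deriv hω x₀ hx hM2'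
  have hcd := lang_g_contDiff β ωp x₀ hx
  set e := hcd.toOpenPartialHomeomorph (lang_g β ωp) hL (by simp) with he
  have hecoe : ∀ y, e y = lang_g β ωp y := fun y => rfl
  have hsrc : x₀ ∈ e.source := hcd.mem_toOpenPartialHomeomorph_source hL (by simp)
  have htgt : ((1 : ℂ), (0 : ℝ)) ∈ e.target := by
    rw [← hg0]; exact e.map_source hsrc
  have hsymm0 : e.symm ((1 : ℂ), (0 : ℝ)) = x₀ := by
    rw [← hg0]; exact e.left_inv hsrc
  have hnear : ∀ᶠ y in 𝓝 x₀, y ∈ e.source ∧ 0 < y.1.re + y.1.im ∧ lang_M β 2 y ≠ 0 := by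
    refine Filter.Eventually.and (e.open_source.mem_nhds hsrc)
      (Filter.Eventually.and (lang_open.mem_nhds hx) ?_)
    exact (lang_M_deriv β 2 x₀ hx).continuousAt.eventually_ne hM2'
  obtain ⟨ρ, hρ, hball⟩ := Metric.eventually_nhds_iff_ball.1 hnear
  set ε := min ρ (ωp / 4) with hε
  have hε0 : 0 < ε := lt_min hρ (by positivity)
  have hεω : ε ≤ ωp / 4 := min_le_right _ _
  have hερ : ε ≤ ρ := min_le_left _ _
  have hpair : ContinuousAt (fun t : ℝ => ((1 : ℂ), t)) 0 := by fun_prop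
  have hcont : Tendsto (fun t : ℝ => e.symm ((1 : ℂ), t)) (𝓝 0) (𝓝 x₀) := by
    have h1 := (e.symm.continuousAt (x := ((1 : ℂ), (0 : ℝ))) htgt).tendsto
    rw [hsymm0] at h1
    exact h1.comp hpair.tendsto
  have hev : ∀ᶠ t in 𝓝 (0 : ℝ), ((1 : ℂ), t) ∈ e.target ∧
      e.symm ((1 : ℂ), t) ∈ Metric.ball x₀ ε :=
    Filter.Eventually.and (hpair.tendsto (e.open_target.mem_nhds htgt)) (hcont (Metric.ball_mem_nhds _ hε0))
  obtain ⟨δ, hδ, hδball⟩ := Metric.eventually_nhds_iff_ball.1 hev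
  have hν : 0 < min 1 (min δ ε) := lt_min one_pos (lt_min hδ hε0)
  have hsq : ∀ k : EuclideanSpace ℝ (Fin 3), ‖k‖ < min 1 (min δ ε) →
      ‖k‖ ^ 2 < δ ∧ ‖k‖ ^ 2 < ε := by
    intro k hk
    have h1 : ‖k‖ < 1 := hk.trans_le (min_le_left _ _)
    have h2 : ‖k‖ < δ := hk.trans_le ((min_le_right _ _).trans (min_le_left _ _))
    have h3 : ‖k‖ < ε := hk.trans_le ((min_le_right _ _).trans (min_le_right _ _))
    have h4 : ‖k‖ ^ 2 ≤ ‖k‖ := by nlinarith [norm_nonneg k]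
    exact ⟨h4.trans_lt h2, h4.trans_lt h3⟩
  have hmain : ∀ k : EuclideanSpace ℝ (Fin 3), ‖k‖ < min 1 (min δ ε) →
      ((1 : ℂ), ‖k‖ ^ 2) ∈ e.target ∧ e.symm ((1 : ℂ), ‖k‖ ^ 2) ∈ Metric.ball x₀ ε := by
    intro k hk
    refine hδball _ ?_
    rw [Metric.mem_ball, dist_zero_right, Real.norm_of_nonneg (by positivity)]
    exact (hsq k hk).1
  have hpn : ∀ k : EuclideanSpace ℝ (Fin 3), ‖k‖ < min 1 (min δ ε) →
      ‖(e.symm ((1 : ℂ), ‖k‖ ^ 2)).1 - I * ωp‖ < ε := by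
    intro k hk
    have h1 := (hmain k hk).2
    rw [Metric.mem_ball, Prod.dist_eq, max_lt_iff] at h1
    simpa [dist_eq_norm, hx₀] using h1.1
  refine ⟨min 1 (min δ ε), hν, ε, ⟨hε0, by linarith⟩,
    fun k => (e.symm ((1 : ℂ), ‖k‖ ^ 2)).1, ?_, ?_, hpn, ?_, ?_⟩
  · intro k hk
    rw [Metric.mem_ball, dist_zero_right] at hk
    obtain ⟨h1, h2⟩ := hmain k hk
    obtain ⟨_, h4, h5⟩ := hball _ (Metric.ball_subset_ball hερ h2)
    obtain ⟨L', hL'⟩ := lang_g_deriv hω _ h4 h5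
    have h6 : ContDiffAt ℝ (⊤ : ℕ∞) e.symm ((1 : ℂ), ‖k‖ ^ 2) :=
      e.contDiffAt_symm h1 hL' (lang_g_contDiff β ωp _ h4)
    have h7 : ContDiffAt ℝ (⊤ : ℕ∞)
        (fun k : EuclideanSpace ℝ (Fin 3) => ((1 : ℂ), ‖k‖ ^ 2)) k :=
      contDiffAt_const.prodMk (contDiff_norm_sq ℝ).contDiffAt
    have h8 := ContDiffAt.comp (g := e.symm) k h6 h7
    exact (contDiffAt_fst.comp k h8).contDiffWithinAt
  · simp [hsymm0, hx₀]
  · intro k hk0 hk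
    obtain ⟨h1, h2⟩ := hmain k hk
    have h3 := e.right_inv h1
    rw [hecoe] at h3
    have h4 : (e.symm ((1 : ℂ), ‖k‖ ^ 2)).2 = ‖k‖ ^ 2 := congrArg Prod.snd h3
    have h5 := congrArg Prod.fst h3
    rw [lang_disp hn hβ hω hk0 ((hpn k hk).trans_le hεω)]
    have h6 : ((e.symm ((1 : ℂ), ‖k‖ ^ 2)).1, ‖k‖ ^ 2) = e.symm ((1 : ℂ), ‖k‖ ^ 2) :=
      Prod.ext rfl h4.symm
    rw [h6]
    exact h5
  · intro k hk0 hk z hz hd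
    rw [lang_disp hn hβ hω hk0 (hz.trans_le hεω)] at hd
    have h1 : (z, ‖k‖ ^ 2) ∈ Metric.ball x₀ ρ := by
      rw [Metric.mem_ball, Prod.dist_eq, max_lt_iff]
      constructor
      · simpa [dist_eq_norm, hx₀] using hz.trans_le hερ
      · simpa [hx₀] using (hsq k hk).2.trans_le hερ
    have h2 := e.left_inv (hball _ h1).1
    have h3 : e (z, ‖k‖ ^ 2) = ((1 : ℂ), ‖k‖ ^ 2) := by
      rw [hecoe, lang_g, hd]
    rw [h3] at h2
    simp only [h2]
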